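/- Let (Z,A) be generated from SBM(n,k,π,ρ_n S) with ρ_n ≥ log n/n and ρ_n s_max ≤ 1/2. Then there exist constants c₁, c₂, c > 0 depending only on S such that for every δ > 0, with probability tending to 1 as n → ∞, simultaneously for all e ∈ [k]^n and all a,b ∈ [k], writing d = d(e,Z) = #{i : e_i ≠ Z_i}: (1) | o_{ab}(e)/n² − o_{ab}(Z)/n² | ≤ c₁ ρ_n d/n; (2) if n_{ab}(Z) > 2nd then | o_{ab}(e)/n_{ab}(e) − o_{ab}(Z)/n_{ab}(Z) | ≤ c₂ ρ_n d n/(n_{ab}(Z) − 2nd); (3) | o_{ab}(e)/n² − E[o_{ab}(e) | Z]/n² | ≤ √(δ ρ_n log n)/n + c ρ_n d/n. -/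

import Mathlib

open Finset Filter
open scoped Classical BigOperators Topology

noncomputable section

namespace SBM

variable {n k : ℕ}

/-- Number of nodes with label `a`. -/
def nCount (z : Fin n → Fin k) (a : Fin k) : ℕ :=
  (Finset.univ.filter fun i => z i = a).card

/-- `n_{ab}(z)`. -/
def nab (z : Fin n → Fin k) (a b : Fin k) : ℝ :=
  if a = b then (nCount z a : ℝ) * ((nCount z a : ℝ) - 1)
  else (nCount z a : ℝ) * (nCount z b : ℝ)

/-- `o_{ab}(z)`: number of (ordered) edges between communities `a` and `b`. -/
def oab (A : Fin n → Fin n → Bool) (z : Fin n → Fin k) (a b : Fin k) : ℝ :=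
  ∑ i : Fin n, ∑ j : Fin n, if z i = a ∧ z j = b ∧ A i j = true then (1 : ℝ) else 0

/-- `τ(x) = x log x + (1-x) log(1-x)` (with `Real.log 0 = 0`, so `0 log 0 = 0`). -/
def tau (x : ℝ) : ℝ := x * Real.log x + (1 - x) * Real.log (1 - x)

/-- Maximum likelihood modularity. -/
def QML (A : Fin n → Fin n → Bool) (z : Fin n → Fin k) : ℝ :=
  (1 / (2 * (n : ℝ) ^ 2)) *
    ∑ a : Fin k, ∑ b : Fin k, nab z a b * tau (oab A z a b / nab z a b)

/-- The Beta function. -/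
def Beta (x y : ℝ) : ℝ := Real.Gamma x * Real.Gamma y / Real.Gamma (x + y)

def otilde (A : Fin n → Fin n → Bool) (z : Fin n → Fin k) (a b : Fin k) : ℝ :=
  if a = b then oab A z a b / 2 else oab A z a b

def ntilde (z : Fin n → Fin k) (a b : Fin k) : ℝ :=
  if a = b then nab z a b / 2 else nab z a b

/-- Integrated conditional likelihood modularity. -/
def QICL (A : Fin n → Fin n → Bool) (z : Fin n → Fin k) : ℝ :=
  (1 / (n : ℝ) ^ 2) *
    ∑ p ∈ Finset.univ.filter (fun p : Fin k × Fin k => p.1 ≤ p.2),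
      Real.log (Beta (otilde A z p.1 p.2 + 1 / 2)
          (ntilde z p.1 p.2 - otilde A z p.1 p.2 + 1 / 2) / Beta (1 / 2) (1 / 2))

/-- The adjacency matrix is symmetric with zero diagonal. -/
def ValidAdj (A : Fin n → Fin n → Bool) : Prop :=
  (∀ i j, A i j = A j i) ∧ ∀ i, A i i = false

/-- Density of the conditional SBM edge model given the labels `z`:
independent Bernoulli(`ρ S (z i) (z j)`) edges for `i < j`. -/
def edgeDensity (ρ : ℝ) (S : Matrix (Fin k) (Fin k) ℝ) (z : Fin n → Fin k)
    (A : Fin n → Fin n → Bool) : ℝ :=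
  ∏ p ∈ Finset.univ.filter (fun p : Fin n × Fin n => p.1 < p.2),
    (if A p.1 p.2 then ρ * S (z p.1) (z p.2) else 1 - ρ * S (z p.1) (z p.2))

/-- Conditional probability of an event on the adjacency matrix, given labels `z`. -/
def condProb (ρ : ℝ) (S : Matrix (Fin k) (Fin k) ℝ) (z : Fin n → Fin k)
    (E : (Fin n → Fin n → Bool) → Prop) : ℝ :=
  ∑ A : Fin n → Fin n → Bool, if ValidAdj A ∧ E A then edgeDensity ρ S z A else 0

/-- Conditional expectation of a function of the adjacency matrix, given labels `z`. -/
def condExp (ρ : ℝ) (S : Matrix (Fin k) (Fin k) ℝ) (z : Fin n → Fin k)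
    (f : (Fin n → Fin n → Bool) → ℝ) : ℝ :=
  ∑ A : Fin n → Fin n → Bool, if ValidAdj A then edgeDensity ρ S z A * f A else 0

/-- Probability of an event under the SBM: labels are i.i.d. `π`, edges are conditionally
independent Bernoulli(`ρ S (z i) (z j)`). -/
def sbmProb (π : Fin k → ℝ) (ρ : ℝ) (S : Matrix (Fin k) (Fin k) ℝ)
    (E : (Fin n → Fin k) → (Fin n → Fin n → Bool) → Prop) : ℝ :=
  ∑ z : Fin n → Fin k, (∏ i, π (z i)) * condProb ρ S z (E z)

/-- Number of disagreements between two label vectors. -/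
def hamming (e z : Fin n → Fin k) : ℕ :=
  (Finset.univ.filter fun i => e i ≠ z i).card

/-- Misclassification distance: minimum number of disagreements over permutations of labels. -/
def mDist (e z : Fin n → Fin k) : ℕ :=
  Finset.univ.inf' ⟨Equiv.refl (Fin k), Finset.mem_univ _⟩
    (fun σ : Equiv.Perm (Fin k) => (Finset.univ.filter fun i => e i ≠ σ (z i)).card)

/-- Confusion matrix `R(e,z)`. -/
def confusion (e z : Fin n → Fin k) : Matrix (Fin k) (Fin k) ℝ :=
  Matrix.of fun a b => (1 / (n : ℝ)) * ∑ i : Fin n, if e i = a ∧ z i = b then (1 : ℝ) else 0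

/-- `[R 1]_a` : row sums. -/
def rowSum (R : Matrix (Fin k) (Fin k) ℝ) (a : Fin k) : ℝ := ∑ j, R a j

/-- `[Rᵀ 1]_a` : column sums. -/
def colSum (R : Matrix (Fin k) (Fin k) ℝ) (a : Fin k) : ℝ := ∑ i, R i a

/-- `[P_R]_{ab}`. -/
def PR (P R : Matrix (Fin k) (Fin k) ℝ) (n : ℕ) (a b : Fin k) : ℝ :=
  ((R * P * R.transpose) a b - (if a = b then (∑ i, P i i * R a i) / n else 0)) /
    (rowSum R a * (rowSum R b - if a = b then 1 / (n : ℝ) else 0))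

/-- The population modularity `H_{P,n}(R)`. -/
def Hmod (P R : Matrix (Fin k) (Fin k) ℝ) (n : ℕ) : ℝ :=
  (1 / 2) * ∑ a : Fin k, ∑ b : Fin k,
    rowSum R a * (rowSum R b - if a = b then 1 / (n : ℝ) else 0) * tau (PR P R n a b)

/-- The centered modularity `X(e,z)` (with `P = ρ S`). -/
def Xfun (ρ : ℝ) (S : Matrix (Fin k) (Fin k) ℝ) (A : Fin n → Fin n → Bool)
    (e z : Fin n → Fin k) : ℝ :=
  (1 / (2 * (n : ℝ) ^ 2)) * ∑ a : Fin k, ∑ b : Fin k,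
    nab e a b * (tau (oab A e a b / nab e a b) - tau (PR (ρ • S) (confusion e z) n a b))

/-- The limit functional `G_S(R)` (terms with `[RSRᵀ]_{ab} = 0` vanish). -/
def GS (S R : Matrix (Fin k) (Fin k) ℝ) : ℝ :=
  ∑ a : Fin k, ∑ b : Fin k,
    (R * S * R.transpose) a b *
      Real.log ((R * S * R.transpose) a b / (rowSum R a * rowSum R b))

/-- Entry-wise `ℓ¹` norm of a matrix. -/
def l1norm (M : Matrix (Fin k) (Fin k) ℝ) : ℝ := ∑ a : Fin k, ∑ b : Fin k, |M a b|

/-- `s_max`. -/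
def sMax (S : Matrix (Fin k) (Fin k) ℝ) : ℝ :=
  sSup (Set.range fun p : Fin k × Fin k => S p.1 p.2)

/-- `s_min`. -/
def sMin (S : Matrix (Fin k) (Fin k) ℝ) : ℝ :=
  sInf (Set.range fun p : Fin k × Fin k => S p.1 p.2)

/-- `H_t(p‖q) = (1-t)p + tq - p^{1-t} q^t`. -/
def Ht (t p q : ℝ) : ℝ := (1 - t) * p + t * q - p ^ (1 - t) * q ^ t

/-- `max_{t ∈ [0,1]} Σ_a π_a H_t(S_{ab} ‖ S_{ab'})`. -/
def CtMax (π : Fin k → ℝ) (S : Matrix (Fin k) (Fin k) ℝ) (b b' : Fin k) : ℝ :=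
  sSup ((fun t => ∑ a : Fin k, π a * Ht t (S a b) (S a b')) '' Set.Icc (0 : ℝ) 1)

/-- The phase-transition constant `C(π,S)`. -/
def Cconst (π : Fin k → ℝ) (S : Matrix (Fin k) (Fin k) ℝ) : ℝ :=
  sInf {x : ℝ | ∃ b b' : Fin k, b ≠ b' ∧ x = CtMax π S b b'}

/-- `K_t(p‖q) = p^{1-t} q^t + t p log(p/q) - p`. -/
def Kt (t p q : ℝ) : ℝ := p ^ (1 - t) * q ^ t + t * p * Real.log (p / q) - p

/-- `K₁(p‖q) = p log(p/q) + q - p`. -/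
def K1 (p q : ℝ) : ℝ := p * Real.log (p / q) + q - p

/-- Kullback–Leibler divergence between Bernoulli(s) and Bernoulli(t). -/
def KLBern (s t : ℝ) : ℝ := s * Real.log (s / t) + (1 - s) * Real.log ((1 - s) / (1 - t))

/-- Off-diagonal pairs of labels. -/
def offDiag (k : ℕ) : Finset (Fin k × Fin k) :=
  Finset.univ.filter fun p => p.1 ≠ p.2

/-- `C_t(R,S) = Σ_a Σ_{b ≠ b'} [Rᵀ1]_a K_t(S_{ab}‖S_{ab'}) R_{b'b}`. -/
def CtRS (t : ℝ) (R S : Matrix (Fin k) (Fin k) ℝ) : ℝ :=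
  ∑ a : Fin k, ∑ p ∈ offDiag k, colSum R a * Kt t (S a p.1) (S a p.2) * R p.2 p.1

/-- Membership in `F(n,α)`: all communities have size at least `α n`. -/
def inF (α : ℝ) (z : Fin n → Fin k) : Prop := ∀ a, α * n ≤ (nCount z a : ℝ)

/-- `zh` is a maximizer of the ML modularity over `F(n,α)`. -/
def IsMLE (α : ℝ) (A : Fin n → Fin n → Bool) (zh : Fin n → Fin k) : Prop :=
  inF α zh ∧ ∀ e : Fin n → Fin k, inF α e → QML A e ≤ QML A zh

/-- `zh` is a maximizer of the ICL modularity over `F(n,α)`. -/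
def IsICL (α : ℝ) (A : Fin n → Fin n → Bool) (zh : Fin n → Fin k) : Prop :=
  inF α zh ∧ ∀ e : Fin n → Fin k, inF α e → QICL A e ≤ QICL A zh

/-- Total weight of `W` on the ordered pairs of nodes labelled `(a, b)`. -/
def blockSum (W : Fin n → Fin n → ℝ) (z : Fin n → Fin k) (a b : Fin k) : ℝ :=
  ∑ i, ∑ j, if z i = a ∧ z j = b then W i j else 0

/-- The adjacency matrix with real entries. -/
def adjWeight (A : Fin n → Fin n → Bool) (i j : Fin n) : ℝ := if A i j = true then 1 else 0

/-- The conditional mean of the adjacency matrix given the labels. -/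
def meanWeight (ρ : ℝ) (S : Matrix (Fin k) (Fin k) ℝ) (z : Fin n → Fin k) (i j : Fin n) : ℝ :=
  if i = j then 0 else ρ * S (z i) (z j)

theorem oab_eq_blockSum (A : Fin n → Fin n → Bool) (z : Fin n → Fin k) (a b : Fin k) :
    oab A z a b = blockSum (adjWeight A) z a b := by
  unfold oab blockSum adjWeight
  refine Finset.sum_congr rfl fun i _ => Finset.sum_congr rfl fun j _ => ?_
  by_cases h1 : z i = a <;> by_cases h2 : z j = b <;> simp [h1, h2]

theorem nab_eq_blockSum (z : Fin n → Fin k) (a b : Fin k) :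
    nab z a b = blockSum (fun i j => if i = j then 0 else 1) z a b := by
  have h1 : ∀ c, (nCount z c : ℝ) = ∑ i, if z i = c then (1 : ℝ) else 0 := by
    intro c
    simp [nCount]
  have h2 : blockSum (fun i j => if i = j then (0 : ℝ) else 1) z a b =
      (∑ i, ∑ j, (if z i = a then (1 : ℝ) else 0) * (if z j = b then 1 else 0)) -
        ∑ i, if z i = a ∧ z i = b then (1 : ℝ) else 0 := by
    unfold blockSum
    rw [← Finset.sum_sub_distrib]
    refine Finset.sum_congr rfl fun i _ => ?_
    have h3 : (if z i = a ∧ z i = b then (1 : ℝ) else 0) =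
        ∑ j, if i = j then (if z i = a ∧ z j = b then (1 : ℝ) else 0) else 0 := by
      simp
    rw [h3, ← Finset.sum_sub_distrib]
    refine Finset.sum_congr rfl fun j _ => ?_
    by_cases h1 : z i = a <;> by_cases h2 : z j = b <;> by_cases h3 : i = j <;>
      simp [h1, h2, h3]
  rw [h2, ← Finset.sum_mul_sum, ← h1, ← h1]
  unfold nab
  split_ifs with hab
  · subst hab
    simp only [and_self]
    rw [← h1]
    ring
  · have h4 : ∀ i, ¬ (z i = a ∧ z i = b) := fun i h => hab (h.1.symm.trans h.2)
    simp [h4]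

/-- Relabelling `d` nodes changes a block sum by at most `2 d` times the largest row sum. -/
theorem abs_blockSum_sub_le {W : Fin n → Fin n → ℝ} {B : ℝ} (hW : ∀ i j, 0 ≤ W i j)
    (hsymm : ∀ i j, W i j = W j i) (hB : ∀ i, ∑ j, W i j ≤ B) (e z : Fin n → Fin k)
    (a b : Fin k) :
    |blockSum W e a b - blockSum W z a b| ≤ 2 * (hamming e z : ℝ) * B := by
  have hrow : ∑ i, ∑ j, (if e i ≠ z i then W i j else 0) ≤ (hamming e z : ℝ) * B := by
    calc ∑ i, ∑ j, (if e i ≠ z i then W i j else 0)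
        ≤ ∑ i, if e i ≠ z i then B else 0 := by
          refine Finset.sum_le_sum fun i _ => ?_
          split_ifs
          · exact hB i
          · simp
      _ = (hamming e z : ℝ) * B := by
          rw [← Finset.sum_filter, Finset.sum_const, nsmul_eq_mul, hamming]
  have hcol : ∑ i, ∑ j, (if e j ≠ z j then W i j else 0) ≤ (hamming e z : ℝ) * B := by
    rw [Finset.sum_comm]
    refine le_trans (le_of_eq ?_) hrow
    refine Finset.sum_congr rfl fun i _ => Finset.sum_congr rfl fun j _ => ?_
    rw [hsymm]
  unfold blockSum
  rw [← Finset.sum_sub_distrib]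
  calc _ ≤ ∑ i, ∑ j, ((if e i ≠ z i then W i j else 0) + if e j ≠ z j then W i j else 0) := by
        refine (Finset.abs_sum_le_sum_abs _ _).trans (Finset.sum_le_sum fun i _ => ?_)
        rw [← Finset.sum_sub_distrib]
        refine (Finset.abs_sum_le_sum_abs _ _).trans (Finset.sum_le_sum fun j _ => ?_)
        have h0 := hW i j
        by_cases h1 : e i = z i <;> by_cases h2 : e j = z j
        · simp [h1, h2]
        all_goals
          have h3 : |(if e i = a ∧ e j = b then W i j else 0) -
              (if z i = a ∧ z j = b then W i j else 0)| ≤ W i j := by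
            split_ifs <;> simp [abs_of_nonneg h0, h0]
          refine h3.trans ?_
          simp [h1, h2, h0]
    _ ≤ _ := by
        simp only [Finset.sum_add_distrib]
        linarith

theorem condProb_eq_condExp (ρ : ℝ) (S : Matrix (Fin k) (Fin k) ℝ) (z : Fin n → Fin k)
    (E : (Fin n → Fin n → Bool) → Prop) :
    condProb ρ S z E = condExp ρ S z fun A => if E A then 1 else 0 := by
  unfold condProb condExp
  refine Finset.sum_congr rfl fun A _ => ?_
  by_cases h1 : ValidAdj A <;> by_cases h2 : E A <;> simp [h1, h2]

theorem condExp_sum {ι : Type*} (s : Finset ι) (ρ : ℝ) (S : Matrix (Fin k) (Fin k) ℝ)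
    (z : Fin n → Fin k) (f : ι → (Fin n → Fin n → Bool) → ℝ) :
    condExp ρ S z (fun A => ∑ i ∈ s, f i A) = ∑ i ∈ s, condExp ρ S z (f i) := by
  unfold condExp
  rw [Finset.sum_comm]
  refine Finset.sum_congr rfl fun A _ => ?_
  split_ifs
  · rw [Finset.mul_sum]
  · simp

theorem condExp_mul_const (ρ : ℝ) (S : Matrix (Fin k) (Fin k) ℝ)
    (z : Fin n → Fin k) (f : (Fin n → Fin n → Bool) → ℝ) (c : ℝ) :
    condExp ρ S z (fun A => f A * c) = condExp ρ S z f * c := by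
  unfold condExp
  rw [Finset.sum_mul]
  refine Finset.sum_congr rfl fun A _ => ?_
  split_ifs <;> ring

theorem edgeDensity_nonneg {ρ : ℝ} {S : Matrix (Fin k) (Fin k) ℝ} (h0 : ∀ a b, 0 ≤ ρ * S a b)
    (h1 : ∀ a b, ρ * S a b ≤ 1) (z : Fin n → Fin k) (A : Fin n → Fin n → Bool) :
    0 ≤ edgeDensity ρ S z A := by
  refine Finset.prod_nonneg fun p _ => ?_
  split_ifs
  · exact h0 _ _
  · exact sub_nonneg.2 (h1 _ _)

theorem condExp_mono {ρ : ℝ} {S : Matrix (Fin k) (Fin k) ℝ} (h0 : ∀ a b, 0 ≤ ρ * S a b)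
    (h1 : ∀ a b, ρ * S a b ≤ 1) (z : Fin n → Fin k) {f g : (Fin n → Fin n → Bool) → ℝ}
    (hfg : ∀ A, ValidAdj A → f A ≤ g A) : condExp ρ S z f ≤ condExp ρ S z g := by
  unfold condExp
  refine Finset.sum_le_sum fun A _ => ?_
  split_ifs with h
  · exact mul_le_mul_of_nonneg_left (hfg A h) (edgeDensity_nonneg h0 h1 z A)
  · exact le_rfl

/-- Independence of the edges: expectations of products over edges factor. -/
theorem condExp_prod (ρ : ℝ) (S : Matrix (Fin k) (Fin k) ℝ) (z : Fin n → Fin k)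
    (h : Fin n × Fin n → Bool → ℝ) :
    condExp ρ S z (fun A => ∏ p ∈ Finset.univ.filter (fun p : Fin n × Fin n => p.1 < p.2),
        h p (A p.1 p.2)) =
      ∏ p ∈ Finset.univ.filter (fun p : Fin n × Fin n => p.1 < p.2),
        (ρ * S (z p.1) (z p.2) * h p true + (1 - ρ * S (z p.1) (z p.2)) * h p false) := by
  let F : Fin n × Fin n → Bool → ℝ := fun p x =>
    (if x = true then ρ * S (z p.1) (z p.2) else 1 - ρ * S (z p.1) (z p.2)) * h p x
  have hR : ∀ p : Fin n × Fin n, ρ * S (z p.1) (z p.2) * h p true +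
      (1 - ρ * S (z p.1) (z p.2)) * h p false = ∑ x : Bool, F p x := by
    intro p
    simp [F]
  simp_rw [hR]
  unfold condExp edgeDensity
  rw [← Finset.sum_filter]
  simp_rw [← Finset.prod_mul_distrib]
  rw [← Finset.prod_coe_sort, Finset.prod_univ_sum, Fintype.piFinset_univ]
  simp_rw [← Finset.prod_coe_sort (Finset.univ.filter fun p : Fin n × Fin n => p.1 < p.2)]
  refine Finset.sum_bij' (fun A _ p => A p.1.1 p.1.2)
    (fun g _ i j => if hij : i < j then g ⟨(i, j), by simpa using hij⟩
      else if hji : j < i then g ⟨(j, i), by simpa using hji⟩ else false) ?_ ?_ ?_ ?_ ?_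
  · intro A _
    exact Finset.mem_univ _
  · intro g _
    refine Finset.mem_filter.2 ⟨Finset.mem_univ _, fun i j => ?_, fun i => by simp⟩
    rcases lt_trichotomy i j with hij | hij | hij
    · simp [hij, hij.not_gt]
    · simp [hij]
    · simp [hij, hij.not_gt]
  · intro A hA
    have hA' := (Finset.mem_filter.1 hA).2
    funext i j
    rcases lt_trichotomy i j with hij | hij | hij
    · simp [hij]
    · subst hij
      simp [hA'.2 i]
    · simp [hij, hij.not_gt, hA'.1 i j]
  · intro g _
    funext p
    have hp := (Finset.mem_filter.1 p.2).2
    simp [hp]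
  · intro A _
    rfl

theorem condExp_congr (ρ : ℝ) (S : Matrix (Fin k) (Fin k) ℝ) (z : Fin n → Fin k)
    {f g : (Fin n → Fin n → Bool) → ℝ} (hfg : ∀ A, ValidAdj A → f A = g A) :
    condExp ρ S z f = condExp ρ S z g := by
  unfold condExp
  refine Finset.sum_congr rfl fun A _ => ?_
  split_ifs with h
  · rw [hfg A h]
  · rfl

theorem condExp_one (ρ : ℝ) (S : Matrix (Fin k) (Fin k) ℝ) (z : Fin n → Fin k) :
    condExp ρ S z (fun _ => 1) = 1 := by
  simpa using condExp_prod ρ S z fun _ _ => 1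

theorem condExp_adjWeight_of_lt (ρ : ℝ) (S : Matrix (Fin k) (Fin k) ℝ) (z : Fin n → Fin k)
    {i j : Fin n} (hij : i < j) :
    condExp ρ S z (fun A => adjWeight A i j) = ρ * S (z i) (z j) := by
  have key := condExp_prod ρ S z fun p x => if p = (i, j) then (if x = true then 1 else 0) else 1
  have h1 : ∀ p : Fin n × Fin n,
      (ρ * S (z p.1) (z p.2) * (if p = (i, j) then (if true = true then 1 else 0) else 1) +
        (1 - ρ * S (z p.1) (z p.2)) * if p = (i, j) then (if false = true then 1 else 0) else 1) =
      if p = (i, j) then ρ * S (z p.1) (z p.2) else 1 := by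
    intro p
    split_ifs <;> simp_all
  have h2 := key.trans (Finset.prod_congr rfl fun p _ => h1 p)
  simp_rw [Finset.prod_ite_eq'] at h2
  simpa [hij, adjWeight] using h2

theorem condExp_adjWeight (ρ : ℝ) {S : Matrix (Fin k) (Fin k) ℝ} (hS : S.IsSymm)
    (z : Fin n → Fin k) (i j : Fin n) :
    condExp ρ S z (fun A => adjWeight A i j) = meanWeight ρ S z i j := by
  rcases lt_trichotomy i j with hij | hij | hij
  · rw [condExp_adjWeight_of_lt ρ S z hij, meanWeight, if_neg hij.ne]
  · subst hij
    rw [condExp_congr ρ S z (g := fun _ => 1 * 0) fun A hA => by simp [adjWeight, hA.2 i],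
      condExp_mul_const]
    simp [meanWeight]
  · rw [condExp_congr ρ S z (g := fun A => adjWeight A j i)
      fun A hA => by simp [adjWeight, hA.1 i j], condExp_adjWeight_of_lt ρ S z hij, meanWeight,
      if_neg hij.ne', hS.apply]

theorem condExp_oab (ρ : ℝ) {S : Matrix (Fin k) (Fin k) ℝ} (hS : S.IsSymm)
    (z e : Fin n → Fin k) (a b : Fin k) :
    condExp ρ S z (fun A => oab A e a b) = blockSum (meanWeight ρ S z) e a b := by
  have h : ∀ (W : Fin n → Fin n → ℝ), blockSum W e a b =
      ∑ i, ∑ j, W i j * if e i = a ∧ e j = b then 1 else 0 := by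
    intro W
    simp [blockSum]
  simp_rw [oab_eq_blockSum, h, condExp_sum, condExp_mul_const, condExp_adjWeight ρ hS]

theorem sum_sum_eq_sum_lt {f : Fin n → Fin n → ℝ} (h : ∀ i, f i i = 0) :
    ∑ i, ∑ j, f i j = ∑ p ∈ Finset.univ.filter (fun p : Fin n × Fin n => p.1 < p.2),
      (f p.1 p.2 + f p.2 p.1) := by
  have h1 : ∀ i j, f i j = (if i < j then f i j else 0) + if j < i then f i j else 0 := by
    intro i j
    rcases lt_trichotomy i j with hij | hij | hij
    · simp [hij, hij.not_gt]
    · simp [hij, h]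
    · simp [hij, hij.not_gt]
  calc ∑ i, ∑ j, f i j
      = ∑ i, ∑ j, (if i < j then f i j else 0) + ∑ i, ∑ j, if j < i then f i j else 0 := by
        simp_rw [← Finset.sum_add_distrib]
        exact Finset.sum_congr rfl fun i _ => Finset.sum_congr rfl fun j _ => h1 i j
    _ = ∑ i, ∑ j, (if i < j then f i j else 0) + ∑ i, ∑ j, if i < j then f j i else 0 := by
        rw [Finset.sum_comm (f := fun i j => if j < i then f i j else 0)]
    _ = _ := by
        rw [Finset.sum_filter, Fintype.sum_prod_type]
        simp_rw [← Finset.sum_add_distrib]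
        refine Finset.sum_congr rfl fun i _ => Finset.sum_congr rfl fun j _ => ?_
        split_ifs <;> simp

theorem bernoulli_mgf_le {q w : ℝ} (hq : 0 ≤ q) (hw : |w| ≤ 1) :
    q * Real.exp (w * (1 - q)) + (1 - q) * Real.exp (w * (0 - q)) ≤ Real.exp (q * w ^ 2) := by
  have h1 : Real.exp w ≤ 1 + w + w ^ 2 := by
    have := (abs_le.1 (Real.abs_exp_sub_one_sub_id_le hw)).2
    linarith
  calc q * Real.exp (w * (1 - q)) + (1 - q) * Real.exp (w * (0 - q))
      = Real.exp (-(w * q)) * (q * (Real.exp w - 1) + 1) := by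
        rw [show w * (1 - q) = -(w * q) + w by ring, show w * (0 - q) = -(w * q) by ring,
          Real.exp_add]
        ring
    _ ≤ Real.exp (-(w * q)) * Real.exp (q * (w + w ^ 2)) := by
        refine mul_le_mul_of_nonneg_left ?_ (Real.exp_pos _).le
        refine le_trans ?_ (Real.add_one_le_exp _)
        have := mul_le_mul_of_nonneg_left h1 hq
        linarith
    _ = Real.exp (q * w ^ 2) := by
        rw [← Real.exp_add]
        ring_nf

theorem condExp_exp_le {ρ : ℝ} {S : Matrix (Fin k) (Fin k) ℝ} (hS : S.IsSymm)
    (h0 : ∀ a b, 0 ≤ ρ * S a b) (h1 : ∀ a b, ρ * S a b ≤ 1) (z : Fin n → Fin k)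
    {c : Fin n → Fin n → ℝ} (hc : ∀ i j, |c i j| ≤ 1 / 2) :
    condExp ρ S z (fun A => Real.exp (∑ i, ∑ j, c i j * (adjWeight A i j - meanWeight ρ S z i j)))
      ≤ Real.exp (2 * ∑ i, ∑ j, c i j ^ 2 * meanWeight ρ S z i j) := by
  have hE : ∀ A : Fin n → Fin n → Bool, ValidAdj A →
      Real.exp (∑ i, ∑ j, c i j * (adjWeight A i j - meanWeight ρ S z i j)) =
      ∏ p ∈ Finset.univ.filter (fun p : Fin n × Fin n => p.1 < p.2),
        Real.exp ((c p.1 p.2 + c p.2 p.1) *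
          ((if A p.1 p.2 = true then 1 else 0) - ρ * S (z p.1) (z p.2))) := by
    intro A hA
    rw [sum_sum_eq_sum_lt fun i => by simp [adjWeight, meanWeight, hA.2 i], Real.exp_sum]
    refine Finset.prod_congr rfl fun p hp => ?_
    have hp' := (Finset.mem_filter.1 hp).2
    simp only [adjWeight, meanWeight, if_neg hp'.ne, if_neg hp'.ne', hA.1 p.2 p.1,
      hS.apply (z p.1) (z p.2)]
    ring_nf
  rw [condExp_congr ρ S z hE, condExp_prod ρ S z fun p x =>
    Real.exp ((c p.1 p.2 + c p.2 p.1) * ((if x = true then 1 else 0) - ρ * S (z p.1) (z p.2))),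
    Finset.mul_sum]
  simp_rw [Finset.mul_sum]
  rw [sum_sum_eq_sum_lt fun i => by simp [meanWeight], Real.exp_sum]
  refine Finset.prod_le_prod (fun p _ => ?_) fun p hp => ?_
  · exact add_nonneg (mul_nonneg (h0 _ _) (Real.exp_pos _).le)
      (mul_nonneg (sub_nonneg.2 (h1 _ _)) (Real.exp_pos _).le)
  · have hp' := (Finset.mem_filter.1 hp).2
    have hw : |c p.1 p.2 + c p.2 p.1| ≤ 1 :=
      (abs_add_le _ _).trans (by linarith [hc p.1 p.2, hc p.2 p.1])
    refine le_trans (le_of_eq ?_) ((bernoulli_mgf_le (h0 (z p.1) (z p.2)) hw).trans ?_)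
    · simp
    · refine Real.exp_le_exp.2 ?_
      simp only [meanWeight, if_neg hp'.ne, if_neg hp'.ne', hS.apply (z p.1) (z p.2)]
      nlinarith [mul_nonneg (h0 (z p.1) (z p.2)) (sq_nonneg (c p.1 p.2 - c p.2 p.1))]

/-- Chernoff bound for linear statistics of the centred adjacency matrix. -/
theorem condProb_chernoff {ρ : ℝ} {S : Matrix (Fin k) (Fin k) ℝ} (hS : S.IsSymm)
    (h0 : ∀ a b, 0 ≤ ρ * S a b) (h1 : ∀ a b, ρ * S a b ≤ 1) (z : Fin n → Fin k)
    {c : Fin n → Fin n → ℝ} (hc : ∀ i j, |c i j| ≤ 1 / 2) (t : ℝ) :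
    condProb ρ S z
        (fun A => t ≤ ∑ i, ∑ j, c i j * (adjWeight A i j - meanWeight ρ S z i j))
      ≤ Real.exp (2 * (∑ i, ∑ j, c i j ^ 2 * meanWeight ρ S z i j) - t) := by
  rw [condProb_eq_condExp, Real.exp_sub, div_eq_mul_inv, ← Real.exp_neg]
  refine le_trans ?_ (mul_le_mul_of_nonneg_right (condExp_exp_le hS h0 h1 z hc)
    (Real.exp_pos _).le)
  rw [← condExp_mul_const]
  refine condExp_mono h0 h1 z fun A _ => ?_
  rw [← Real.exp_add]
  split_ifs with h
  · exact Real.one_le_exp (by linarith)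
  · exact (Real.exp_pos _).le

theorem condProb_exists_le {ι : Type*} [Fintype ι] {ρ : ℝ} {S : Matrix (Fin k) (Fin k) ℝ}
    (h0 : ∀ a b, 0 ≤ ρ * S a b) (h1 : ∀ a b, ρ * S a b ≤ 1) (z : Fin n → Fin k)
    (E : ι → (Fin n → Fin n → Bool) → Prop) {ε : ℝ} (hE : ∀ i, condProb ρ S z (E i) ≤ ε) :
    condProb ρ S z (fun A => ∃ i, E i A) ≤ Fintype.card ι * ε := by
  calc condProb ρ S z (fun A => ∃ i, E i A) ≤ ∑ i, condProb ρ S z (E i) := by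
        simp_rw [condProb_eq_condExp]
        rw [← condExp_sum]
        refine condExp_mono h0 h1 z fun A _ => ?_
        have hnn : ∀ i ∈ Finset.univ, (0 : ℝ) ≤ if E i A then 1 else 0 := by
          intro i _
          split_ifs <;> norm_num
        split_ifs with h
        · obtain ⟨i, hi⟩ := h
          refine le_trans ?_ (Finset.single_le_sum hnn (Finset.mem_univ i))
          simp [hi]
        · exact Finset.sum_nonneg hnn
    _ ≤ Fintype.card ι * ε := by
        refine (Finset.sum_le_sum fun i _ => hE i).trans (le_of_eq ?_)
        simp

theorem condProb_mono {ρ : ℝ} {S : Matrix (Fin k) (Fin k) ℝ} (h0 : ∀ a b, 0 ≤ ρ * S a b)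
    (h1 : ∀ a b, ρ * S a b ≤ 1) (z : Fin n → Fin k) {E F : (Fin n → Fin n → Bool) → Prop}
    (h : ∀ A, ValidAdj A → E A → F A) : condProb ρ S z E ≤ condProb ρ S z F := by
  simp_rw [condProb_eq_condExp]
  refine condExp_mono h0 h1 z fun A hA => ?_
  have := h A hA
  split_ifs <;> first | tauto | norm_num

theorem condProb_or_le {ρ : ℝ} {S : Matrix (Fin k) (Fin k) ℝ} (h0 : ∀ a b, 0 ≤ ρ * S a b)
    (h1 : ∀ a b, ρ * S a b ≤ 1) (z : Fin n → Fin k) (E F : (Fin n → Fin n → Bool) → Prop) :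
    condProb ρ S z (fun A => E A ∨ F A) ≤ condProb ρ S z E + condProb ρ S z F := by
  unfold condProb
  rw [← Finset.sum_add_distrib]
  refine Finset.sum_le_sum fun A _ => ?_
  have := edgeDensity_nonneg h0 h1 z A
  by_cases hA : ValidAdj A <;> by_cases hE : E A <;> by_cases hF : F A <;> simp [hA, hE, hF, this]

theorem condProb_true (ρ : ℝ) (S : Matrix (Fin k) (Fin k) ℝ) (z : Fin n → Fin k) :
    condProb ρ S z (fun _ => True) = 1 := by
  rw [condProb_eq_condExp]
  simpa using condExp_one ρ S z

theorem condProb_indicator_le {ρ : ℝ} {S : Matrix (Fin k) (Fin k) ℝ} (hS : S.IsSymm)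
    (h0 : ∀ a b, 0 ≤ ρ * S a b) (h1 : ∀ a b, ρ * S a b ≤ 1) (z : Fin n → Fin k)
    (P : Fin n → Fin n → Prop) [∀ i j, Decidable (P i j)] {θ : ℝ} (hθ : |θ| ≤ 1 / 2) (t : ℝ) :
    condProb ρ S z (fun A => t ≤ θ * ((∑ i, ∑ j, if P i j then adjWeight A i j else 0) -
        ∑ i, ∑ j, if P i j then meanWeight ρ S z i j else 0))
      ≤ Real.exp (2 * (θ ^ 2 * ∑ i, ∑ j, if P i j then meanWeight ρ S z i j else 0) - t) := by
  have key := condProb_chernoff hS h0 h1 z (c := fun i j => if P i j then θ else 0)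
    (fun i j => by split_ifs <;> [exact hθ; norm_num]) t
  convert key using 5
  · simp_rw [← Finset.sum_sub_distrib, Finset.mul_sum]
    refine Finset.sum_congr rfl fun i _ => Finset.sum_congr rfl fun j _ => ?_
    split_ifs <;> ring
  · simp_rw [Finset.mul_sum]
    refine Finset.sum_congr rfl fun i _ => Finset.sum_congr rfl fun j _ => ?_
    split_ifs <;> ring

theorem condProb_upper_tail_le {ρ s N : ℝ} {S : Matrix (Fin k) (Fin k) ℝ} (hS : S.IsSymm)
    (h0 : ∀ a b, 0 ≤ ρ * S a b) (h1 : ∀ a b, ρ * S a b ≤ 1) (z : Fin n → Fin k)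
    (P : Fin n → Fin n → Prop) [∀ i j, Decidable (P i j)]
    (hN : (∑ i, ∑ j, if P i j then meanWeight ρ S z i j else 0) ≤ s * ρ * N) :
    condProb ρ S z (fun A => (2 * s + 4) * ρ * N < ∑ i, ∑ j, if P i j then adjWeight A i j else 0)
      ≤ Real.exp (-2 * (ρ * N)) := by
  refine (condProb_mono h0 h1 z (fun A _ hA => ?_)).trans ((condProb_indicator_le hS h0 h1 z P
    (θ := 1 / 2) (by norm_num) ((s / 2 + 2) * ρ * N)).trans (Real.exp_le_exp.2 ?_))
  · linarith
  · linarith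

theorem meanWeight_nonneg {ρ : ℝ} {S : Matrix (Fin k) (Fin k) ℝ} (h0 : ∀ a b, 0 ≤ ρ * S a b)
    (z : Fin n → Fin k) (i j : Fin n) : 0 ≤ meanWeight ρ S z i j := by
  unfold meanWeight
  split_ifs
  · exact le_rfl
  · exact h0 _ _

theorem meanWeight_le {ρ s : ℝ} {S : Matrix (Fin k) (Fin k) ℝ} (hρ : 0 ≤ ρ) (hs0 : 0 ≤ s)
    (hs : ∀ a b, S a b ≤ s) (z : Fin n → Fin k) (i j : Fin n) :
    meanWeight ρ S z i j ≤ s * ρ := by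
  unfold meanWeight
  split_ifs
  · positivity
  · linarith [mul_le_mul_of_nonneg_left (hs (z i) (z j)) hρ]

theorem sum_meanWeight_le {ρ s : ℝ} {S : Matrix (Fin k) (Fin k) ℝ} (hρ : 0 ≤ ρ) (hs0 : 0 ≤ s)
    (hs : ∀ a b, S a b ≤ s) (z : Fin n → Fin k) (i : Fin n) :
    ∑ j, meanWeight ρ S z i j ≤ s * ρ * n := by
  refine (Finset.sum_le_sum fun j _ => meanWeight_le hρ hs0 hs z i j).trans (le_of_eq ?_)
  simp
  ring

theorem blockSum_meanWeight_le {ρ s : ℝ} {S : Matrix (Fin k) (Fin k) ℝ} (hρ : 0 ≤ ρ)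
    (hs : ∀ a b, S a b ≤ s) (z e : Fin n → Fin k) (a b : Fin k) :
    blockSum (meanWeight ρ S z) e a b ≤ s * ρ * nab e a b := by
  rw [nab_eq_blockSum]
  unfold blockSum
  simp_rw [Finset.mul_sum]
  refine Finset.sum_le_sum fun i _ => Finset.sum_le_sum fun j _ => ?_
  unfold meanWeight
  split_ifs
  · simp
  · linarith [mul_le_mul_of_nonneg_left (hs (z i) (z j)) hρ]
  · simp

theorem nab_le_sq (z : Fin n → Fin k) (a b : Fin k) : nab z a b ≤ (n : ℝ) ^ 2 := by
  rw [nab_eq_blockSum]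
  unfold blockSum
  calc _ ≤ ∑ _i : Fin n, ∑ _j : Fin n, (1 : ℝ) := by
        refine Finset.sum_le_sum fun i _ => Finset.sum_le_sum fun j _ => ?_
        split_ifs
        · dsimp only
          split_ifs <;> norm_num
        · norm_num
    _ = (n : ℝ) ^ 2 := by
        simp
        ring

theorem condProb_degree_le {ρ s : ℝ} {S : Matrix (Fin k) (Fin k) ℝ} (hS : S.IsSymm)
    (h0 : ∀ a b, 0 ≤ ρ * S a b) (h1 : ∀ a b, ρ * S a b ≤ 1) (hρ : 0 ≤ ρ) (hs0 : 0 ≤ s)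
    (hs : ∀ a b, S a b ≤ s) (z : Fin n → Fin k) (i : Fin n) :
    condProb ρ S z (fun A => (2 * s + 4) * ρ * n < ∑ j, adjWeight A i j)
      ≤ Real.exp (-2 * (ρ * n)) := by
  have hrow : ∀ W : Fin n → Fin n → ℝ,
      (∑ i', ∑ j, if i' = i then W i' j else 0) = ∑ j, W i j := by
    intro W
    rw [Finset.sum_comm]
    simp
  have key := condProb_upper_tail_le hS h0 h1 z (fun i' _ => i' = i) (s := s) (N := n)
    (by rw [hrow]; exact sum_meanWeight_le hρ hs0 hs z i)
  simpa only [hrow] using key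

theorem condProb_block_le {ρ s : ℝ} {S : Matrix (Fin k) (Fin k) ℝ} (hS : S.IsSymm)
    (h0 : ∀ a b, 0 ≤ ρ * S a b) (h1 : ∀ a b, ρ * S a b ≤ 1) (hρ : 0 ≤ ρ)
    (hs : ∀ a b, S a b ≤ s) (z : Fin n → Fin k) (a b : Fin k) :
    condProb ρ S z (fun A => (2 * s + 4) * ρ * nab z a b < oab A z a b)
      ≤ Real.exp (-2 * (ρ * nab z a b)) := by
  simp_rw [oab_eq_blockSum]
  exact condProb_upper_tail_le hS h0 h1 z (fun i j => z i = a ∧ z j = b)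
    (blockSum_meanWeight_le hρ hs z z a b)

theorem condProb_deviation_le {ρ s δ : ℝ} {S : Matrix (Fin k) (Fin k) ℝ} (hS : S.IsSymm)
    (h0 : ∀ a b, 0 ≤ ρ * S a b) (h1 : ∀ a b, ρ * S a b ≤ 1) (hρ : 0 < ρ) (hs1 : 1 ≤ s)
    (hs : ∀ a b, S a b ≤ s) (hδ : 0 < δ) (hn : 0 < n) (hlog : Real.log n ≤ ρ * n)
    (hδn : δ ≤ n) (z : Fin n → Fin k) (a b : Fin k) :
    condProb ρ S z (fun A => n * Real.sqrt (δ * ρ * Real.log n) <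
        |oab A z a b - blockSum (meanWeight ρ S z) z a b|)
      ≤ 2 * Real.exp (-(δ / (8 * s)) * Real.log n) := by
  have hn' : (1 : ℝ) ≤ n := by exact_mod_cast hn
  have hn0 : (0 : ℝ) < n := by linarith
  have hL : 0 ≤ Real.log n := Real.log_nonneg hn'
  have hs0 : 0 < s := by linarith
  set r := Real.sqrt (δ * ρ * Real.log n) with hr
  have hr0 : 0 ≤ r := Real.sqrt_nonneg _
  have hr2 : r ^ 2 = δ * ρ * Real.log n := Real.sq_sqrt (by positivity)
  have hr_le : r ≤ ρ * n := by
    refine Real.sqrt_le_iff.2 ⟨by positivity, ?_⟩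
    calc δ * ρ * Real.log n ≤ n * ρ * (ρ * n) := by gcongr
      _ = (ρ * n) ^ 2 := by ring
  set θ := r / (4 * s * ρ * n) with hθ
  have hθ0 : 0 ≤ θ := by positivity
  have hθ1 : |θ| ≤ 1 / 2 := by
    rw [abs_of_nonneg hθ0, hθ, div_le_iff₀ (by positivity)]
    nlinarith [mul_pos hρ hn0]
  have hm : blockSum (meanWeight ρ S z) z a b ≤ s * ρ * (n : ℝ) ^ 2 :=
    (blockSum_meanWeight_le hρ.le hs z z a b).trans
      (mul_le_mul_of_nonneg_left (nab_le_sq z a b) (by positivity))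
  have hexp : 2 * (θ ^ 2 * blockSum (meanWeight ρ S z) z a b) - θ * (n * r) ≤
      -(δ / (8 * s)) * Real.log n := by
    calc 2 * (θ ^ 2 * blockSum (meanWeight ρ S z) z a b) - θ * (n * r)
        ≤ 2 * (θ ^ 2 * (s * ρ * (n : ℝ) ^ 2)) - θ * (n * r) := by gcongr
      _ = -(r ^ 2 / (8 * s * ρ)) := by
          rw [hθ]
          field_simp
          ring
      _ = -(δ / (8 * s)) * Real.log n := by
          rw [hr2]
          field_simp
  have hside : ∀ η : ℝ, |η| ≤ 1 / 2 → η ^ 2 = θ ^ 2 →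
      condProb ρ S z (fun A => θ * (n * r) ≤ η * (oab A z a b -
        blockSum (meanWeight ρ S z) z a b)) ≤ Real.exp (-(δ / (8 * s)) * Real.log n) := by
    intro η hη hη2
    simp_rw [oab_eq_blockSum]
    refine (condProb_indicator_le hS h0 h1 z (fun i j => z i = a ∧ z j = b) hη _).trans
      (Real.exp_le_exp.2 ?_)
    rw [hη2]
    exact hexp
  rw [two_mul]
  refine le_trans ?_ (add_le_add (hside θ hθ1 rfl) (hside (-θ) (by rwa [abs_neg]) (by ring)))
  refine le_trans (condProb_mono h0 h1 z fun A _ hA => ?_) (condProb_or_le h0 h1 z _ _)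
  rcases lt_abs.1 hA with h | h
  · exact Or.inl (mul_le_mul_of_nonneg_left h.le hθ0)
  · right
    have := mul_le_mul_of_nonneg_left h.le hθ0
    linarith

theorem hamming_eq_zero {e z : Fin n → Fin k} (h : hamming e z = 0) : e = z := by
  funext i
  by_contra hi
  have := Finset.filter_eq_empty_iff.1 (Finset.card_eq_zero.1 h) (Finset.mem_univ i)
  exact this hi

theorem adjWeight_nonneg (A : Fin n → Fin n → Bool) (i j : Fin n) : 0 ≤ adjWeight A i j := by
  unfold adjWeight
  split_ifs <;> norm_num

theorem abs_oab_sub_le {A : Fin n → Fin n → Bool} (hA : ValidAdj A) {B : ℝ}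
    (hB : ∀ i, ∑ j, adjWeight A i j ≤ B) (e z : Fin n → Fin k) (a b : Fin k) :
    |oab A e a b - oab A z a b| ≤ 2 * (hamming e z : ℝ) * B := by
  simp_rw [oab_eq_blockSum]
  exact abs_blockSum_sub_le (adjWeight_nonneg A) (fun i j => by simp [adjWeight, hA.1 i j]) hB e z
    a b

theorem abs_nab_sub_le (e z : Fin n → Fin k) (a b : Fin k) :
    |nab e a b - nab z a b| ≤ 2 * (hamming e z : ℝ) * n := by
  simp_rw [nab_eq_blockSum]
  refine abs_blockSum_sub_le (fun i j => by split_ifs <;> norm_num) (fun i j => by simp [eq_comm])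
    (fun i => ?_) e z a b
  calc ∑ j, (if i = j then (0 : ℝ) else 1) ≤ ∑ _j : Fin n, (1 : ℝ) := by
        refine Finset.sum_le_sum fun j _ => ?_
        split_ifs <;> norm_num
    _ = n := by simp

theorem abs_div_sub_div_le {x y u v D K : ℝ} (hxy : |x - y| ≤ K * D) (huv : |u - v| ≤ D)
    (hD : 0 ≤ D) (hK : 0 ≤ K) (hy0 : 0 ≤ y) (hy : y ≤ K * v) (hv : D < v) :
    |x / u - y / v| ≤ 2 * K * D / (v - D) := by
  have hv0 : 0 < v := by linarith
  have hu : v - D ≤ u := by linarith [(abs_le.1 huv).1]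
  have hvD : 0 < v - D := by linarith
  have hu0 : 0 < u := by linarith
  have hyv : |y / v| ≤ K := by
    rw [abs_of_nonneg (by positivity), div_le_iff₀ hv0]
    exact hy
  have h : x / u - y / v = ((x - y) - y / v * (u - v)) / u := by
    field_simp
    ring
  rw [h, abs_div, abs_of_pos hu0]
  have hnum : |x - y - y / v * (u - v)| ≤ 2 * K * D := by
    calc |x - y - y / v * (u - v)| ≤ |x - y| + |y / v| * |u - v| := by
          rw [← abs_mul]
          exact abs_sub _ _
      _ ≤ K * D + K * D := by gcongr
      _ = 2 * K * D := by ring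
  exact div_le_div₀ (by positivity) hnum hvD hu

/-- The event whose probability is estimated in the uniform comparison of edge counts. -/
def UniformComparison (c₁ c₂ c δ ρ : ℝ) (S : Matrix (Fin k) (Fin k) ℝ) (z : Fin n → Fin k)
    (A : Fin n → Fin n → Bool) : Prop :=
  ∀ e : Fin n → Fin k, ∀ a b : Fin k,
    (|oab A e a b / (n : ℝ) ^ 2 - oab A z a b / (n : ℝ) ^ 2| ≤
        c₁ * ρ * (hamming e z : ℝ) / n) ∧
    (2 * n * (hamming e z : ℝ) < nab z a b →
      |oab A e a b / nab e a b - oab A z a b / nab z a b| ≤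
        c₂ * ρ * (hamming e z : ℝ) * n / (nab z a b - 2 * n * (hamming e z : ℝ))) ∧
    (|oab A e a b / (n : ℝ) ^ 2 - condExp ρ S z (fun A' => oab A' e a b) / (n : ℝ) ^ 2| ≤
      Real.sqrt (δ * ρ * Real.log n) / n + c * ρ * (hamming e z : ℝ) / n)

theorem uniformComparison_of_bounds {ρ s δ : ℝ} {S : Matrix (Fin k) (Fin k) ℝ} (hS : S.IsSymm)
    (h0 : ∀ a b, 0 ≤ ρ * S a b) (hρ : 0 < ρ) (hs0 : 0 < s) (hs : ∀ a b, S a b ≤ s) (hn : 0 < n)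
    (z : Fin n → Fin k) {A : Fin n → Fin n → Bool} (hA : ValidAdj A)
    (hdeg : ∀ i, ∑ j, adjWeight A i j ≤ (2 * s + 4) * ρ * n)
    (hblock : ∀ a b, (2 * n : ℝ) < nab z a b → oab A z a b ≤ (2 * s + 4) * ρ * nab z a b)
    (hdev : ∀ a b, |oab A z a b - blockSum (meanWeight ρ S z) z a b| ≤
      n * Real.sqrt (δ * ρ * Real.log n)) :
    UniformComparison (2 * (2 * s + 4)) (4 * (2 * s + 4)) (2 * (2 * s + 4) + 2 * s) δ ρ S z A := by
  intro e a b
  have hn0 : (0 : ℝ) < n := by exact_mod_cast hn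
  have ho := abs_oab_sub_le hA hdeg e z a b
  have hnab := abs_nab_sub_le e z a b
  have hd0 : (0 : ℝ) ≤ hamming e z := Nat.cast_nonneg _
  refine ⟨?_, fun hlt => ?_, ?_⟩
  · rw [← sub_div, abs_div, abs_of_pos (by positivity : (0 : ℝ) < (n : ℝ) ^ 2),
      div_le_div_iff₀ (by positivity) hn0]
    calc |oab A e a b - oab A z a b| * n
        ≤ (2 * (hamming e z : ℝ) * ((2 * s + 4) * ρ * n)) * n := by gcongr
      _ = _ := by ring
  · rcases Nat.eq_zero_or_pos (hamming e z) with hd | hd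
    · rw [hamming_eq_zero hd]
      simp [hamming]
    · have hd1 : (1 : ℝ) ≤ hamming e z := by exact_mod_cast hd
      have hlt2 : (2 * n : ℝ) < nab z a b := by nlinarith
      have key := abs_div_sub_div_le (x := oab A e a b) (y := oab A z a b) (u := nab e a b)
        (v := nab z a b) (D := 2 * (hamming e z : ℝ) * n) (K := (2 * s + 4) * ρ)
        (ho.trans (le_of_eq (by ring))) hnab (by positivity) (by positivity)
        (by rw [oab_eq_blockSum]
            exact Finset.sum_nonneg fun i _ => Finset.sum_nonneg fun j _ => by
              split_ifs
              · exact adjWeight_nonneg A i j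
              · exact le_rfl)
        (hblock a b hlt2) (by linarith)
      refine key.trans (le_of_eq ?_)
      ring_nf
  · rw [condExp_oab ρ hS, ← sub_div, abs_div, abs_of_pos (by positivity : (0 : ℝ) < (n : ℝ) ^ 2),
      ← add_div, div_le_div_iff₀ (by positivity) hn0]
    have hmean := abs_blockSum_sub_le (meanWeight_nonneg h0 z)
      (fun i j => by simp [meanWeight, eq_comm, hS.apply (z i) (z j)])
      (sum_meanWeight_le hρ.le hs0.le hs z) e z a b
    have htri : |oab A e a b - blockSum (meanWeight ρ S z) e a b| ≤
        n * Real.sqrt (δ * ρ * Real.log n) +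
          (2 * (2 * s + 4) + 2 * s) * ρ * (hamming e z : ℝ) * n := by
      have h3 := hdev a b
      rw [abs_le] at ho hmean h3 ⊢
      constructor <;> nlinarith [ho.1, ho.2, hmean.1, hmean.2, h3.1, h3.2]
    calc |oab A e a b - blockSum (meanWeight ρ S z) e a b| * n
        ≤ (n * Real.sqrt (δ * ρ * Real.log n) +
          (2 * (2 * s + 4) + 2 * s) * ρ * (hamming e z : ℝ) * n) * n := by gcongr
      _ = _ := by ring

/-- Upper bound for the conditional probability that the uniform comparison fails. -/
def failureBound (k : ℕ) (s δ : ℝ) (n : ℕ) : ℝ :=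
  n * Real.exp (-2 * Real.log n) + (k * k * Real.exp (-2 * Real.log n) +
    k * k * (2 * Real.exp (-(δ / (8 * s)) * Real.log n)))

theorem one_sub_failureBound_le_condProb {ρ s δ : ℝ} {S : Matrix (Fin k) (Fin k) ℝ}
    (hS : S.IsSymm) (h0 : ∀ a b, 0 ≤ ρ * S a b) (h1 : ∀ a b, ρ * S a b ≤ 1) (hρ : 0 < ρ)
    (hs1 : 1 ≤ s) (hs : ∀ a b, S a b ≤ s) (hδ : 0 < δ) (hn : 0 < n)
    (hlog : Real.log n ≤ ρ * n) (hδn : δ ≤ n) (z : Fin n → Fin k) :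
    1 - failureBound k s δ n ≤ condProb ρ S z (UniformComparison (2 * (2 * s + 4))
      (4 * (2 * s + 4)) (2 * (2 * s + 4) + 2 * s) δ ρ S z) := by
  have hs0 : 0 < s := by linarith
  have hdeg := condProb_exists_le h0 h1 z
    (fun (i : Fin n) A => (2 * s + 4) * ρ * n < ∑ j, adjWeight A i j)
    (ε := Real.exp (-2 * Real.log n)) fun i =>
      (condProb_degree_le hS h0 h1 hρ.le hs0.le hs z i).trans (Real.exp_le_exp.2 (by linarith))
  have hblock := condProb_exists_le h0 h1 z
    (fun (p : Fin k × Fin k) A => (2 * n : ℝ) < nab z p.1 p.2 ∧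
      (2 * s + 4) * ρ * nab z p.1 p.2 < oab A z p.1 p.2)
    (ε := Real.exp (-2 * Real.log n)) fun p => by
      by_cases hp : (2 * n : ℝ) < nab z p.1 p.2
      · refine (condProb_mono h0 h1 z fun A _ hA => hA.2).trans
          ((condProb_block_le hS h0 h1 hρ.le hs z p.1 p.2).trans (Real.exp_le_exp.2 ?_))
        have hn0 : (0 : ℝ) < n := by exact_mod_cast hn
        nlinarith
      · simp only [hp, false_and]
        refine le_trans (le_of_eq ?_) (Real.exp_pos _).le
        simp [condProb]
  have hdev := condProb_exists_le h0 h1 z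
    (fun (p : Fin k × Fin k) A => n * Real.sqrt (δ * ρ * Real.log n) <
        |oab A z p.1 p.2 - blockSum (meanWeight ρ S z) z p.1 p.2|)
    fun p => condProb_deviation_le hS h0 h1 hρ hs1 hs hδ hn hlog hδn z p.1 p.2
  simp only [Fintype.card_fin, Fintype.card_prod, Nat.cast_mul] at hdeg hblock hdev
  rw [sub_le_iff_le_add, ← condProb_true ρ S z]
  refine le_trans ?_ (add_le_add le_rfl (add_le_add hdeg (add_le_add hblock hdev)))
  refine le_trans ?_ (add_le_add le_rfl (add_le_add le_rfl (condProb_or_le h0 h1 z _ _)))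
  refine le_trans ?_ (add_le_add le_rfl (condProb_or_le h0 h1 z _ _))
  refine le_trans ?_ (condProb_or_le h0 h1 z _ _)
  refine condProb_mono h0 h1 z fun A hA _ => ?_
  by_contra! hcon
  obtain ⟨hE, hd, hb, hv⟩ := hcon
  exact hE (uniformComparison_of_bounds hS h0 hρ hs0 hs hn z hA hd
    (fun a b => hb (a, b)) fun a b => hv (a, b))

theorem tendsto_exp_neg_mul_log {r : ℝ} (hr : 0 < r) :
    Tendsto (fun n : ℕ => Real.exp (-r * Real.log n)) atTop (nhds 0) := by
  refine Real.tendsto_exp_atBot.comp ?_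
  exact (Real.tendsto_log_atTop.comp tendsto_natCast_atTop_atTop).const_mul_atTop_of_neg
    (neg_lt_zero.2 hr)

theorem tendsto_failureBound (k : ℕ) {s δ : ℝ} (hs : 0 < s) (hδ : 0 < δ) :
    Tendsto (failureBound k s δ) atTop (nhds 0) := by
  have h1 : Tendsto (fun n : ℕ => (n : ℝ) * Real.exp (-2 * Real.log n)) atTop (nhds 0) := by
    refine (tendsto_exp_neg_mul_log one_pos).congr' ?_
    filter_upwards [eventually_gt_atTop 0] with n hn
    have hn0 : (0 : ℝ) < n := by exact_mod_cast hn
    nth_rewrite 2 [← Real.exp_log hn0]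
    rw [← Real.exp_add]
    ring_nf
  have h2 := (tendsto_exp_neg_mul_log two_pos).const_mul ((k : ℝ) * k)
  have h3 := ((tendsto_exp_neg_mul_log (r := δ / (8 * s)) (by positivity)).const_mul 2).const_mul
    ((k : ℝ) * k)
  have h4 := h1.add (h2.add h3)
  simp only [mul_zero, add_zero] at h4
  exact h4

theorem sum_prod_labels {π : Fin k → ℝ} (hπ : ∑ a, π a = 1) (n : ℕ) :
    ∑ z : Fin n → Fin k, ∏ i, π (z i) = 1 := by
  rw [← Fintype.sum_pow, hπ, one_pow]

theorem sbmProb_le_one {π : Fin k → ℝ} (hπ0 : ∀ a, 0 < π a) (hπ : ∑ a, π a = 1) {ρ : ℝ}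
    {S : Matrix (Fin k) (Fin k) ℝ} (h0 : ∀ a b, 0 ≤ ρ * S a b) (h1 : ∀ a b, ρ * S a b ≤ 1)
    (E : (Fin n → Fin k) → (Fin n → Fin n → Bool) → Prop) : sbmProb π ρ S E ≤ 1 := by
  unfold sbmProb
  calc _ ≤ ∑ z : Fin n → Fin k, (∏ i, π (z i)) * 1 := by
        refine Finset.sum_le_sum fun z _ => mul_le_mul_of_nonneg_left ?_
          (Finset.prod_nonneg fun i _ => (hπ0 _).le)
        rw [← condProb_true ρ S z]
        exact condProb_mono h0 h1 z fun _ _ _ => trivial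
    _ = 1 := by simp_rw [mul_one, sum_prod_labels hπ]

theorem le_sbmProb {π : Fin k → ℝ} (hπ0 : ∀ a, 0 < π a) (hπ : ∑ a, π a = 1) {ρ q : ℝ}
    {S : Matrix (Fin k) (Fin k) ℝ} {E : (Fin n → Fin k) → (Fin n → Fin n → Bool) → Prop}
    (hE : ∀ z, q ≤ condProb ρ S z (E z)) : q ≤ sbmProb π ρ S E := by
  unfold sbmProb
  calc q = ∑ z : Fin n → Fin k, (∏ i, π (z i)) * q := by
        rw [← Finset.sum_mul, sum_prod_labels hπ, one_mul]
    _ ≤ _ := Finset.sum_le_sum fun z _ => mul_le_mul_of_nonneg_left (hE z)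
          (Finset.prod_nonneg fun i _ => (hπ0 _).le)

theorem le_sMax (S : Matrix (Fin k) (Fin k) ℝ) (a b : Fin k) : S a b ≤ sMax S :=
  le_csSup (Set.finite_range _).bddAbove ⟨(a, b), rfl⟩

/-- uniform comparison of edge counts of any labeling with the truth. -/
theorem stmt18 (k : ℕ) (S : Matrix (Fin k) (Fin k) ℝ) (hSsym : S.IsSymm)
    (hSpos : ∀ a b, 0 < S a b) :
    ∃ c₁ > (0 : ℝ), ∃ c₂ > (0 : ℝ), ∃ c > (0 : ℝ),
      ∀ π : Fin k → ℝ, (∀ a, 0 < π a) → (∑ a, π a = 1) →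
      ∀ ρ : ℕ → ℝ, (∀ n, 0 < ρ n) → (∀ n : ℕ, Real.log n / n ≤ ρ n) →
        (∀ n, ρ n * sMax S ≤ 1 / 2) →
      ∀ δ > (0 : ℝ),
        Tendsto (fun n : ℕ => sbmProb π (ρ n) S
            (fun (z : Fin n → Fin k) (A : Fin n → Fin n → Bool) =>
              ∀ e : Fin n → Fin k, ∀ a b : Fin k,
                (|oab A e a b / (n : ℝ) ^ 2 - oab A z a b / (n : ℝ) ^ 2| ≤
                    c₁ * ρ n * (hamming e z : ℝ) / n) ∧
                (2 * n * (hamming e z : ℝ) < nab z a b →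
                  |oab A e a b / nab e a b - oab A z a b / nab z a b| ≤
                    c₂ * ρ n * (hamming e z : ℝ) * n /
                      (nab z a b - 2 * n * (hamming e z : ℝ))) ∧
                (|oab A e a b / (n : ℝ) ^ 2 -
                      condExp (ρ n) S z (fun A' => oab A' e a b) / (n : ℝ) ^ 2| ≤
                    Real.sqrt (δ * ρ n * Real.log n) / n +
                      c * ρ n * (hamming e z : ℝ) / n)))
          atTop (nhds 1) := by
  set s : ℝ := max (sMax S) 1 with hs_def
  have hs1 : 1 ≤ s := le_max_right _ _
  have hs0 : 0 < s := by linarith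
  refine ⟨2 * (2 * s + 4), by positivity, 4 * (2 * s + 4), by positivity,
    2 * (2 * s + 4) + 2 * s, by positivity, ?_⟩
  intro π hπ0 hπ ρ hρ hlog hmax δ hδ
  have h0 : ∀ n a b, 0 ≤ ρ n * S a b := fun n a b => (mul_pos (hρ n) (hSpos a b)).le
  have h1 : ∀ n a b, ρ n * S a b ≤ 1 := fun n a b =>
    (mul_le_mul_of_nonneg_left (le_sMax S a b) (hρ n).le).trans ((hmax n).trans (by norm_num))
  have hlower : Tendsto (fun n => 1 - failureBound k s δ n) atTop (nhds 1) := by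
    simpa using (tendsto_failureBound k hs0 hδ).const_sub 1
  refine tendsto_of_tendsto_of_tendsto_of_le_of_le' hlower tendsto_const_nhds ?_
    (Eventually.of_forall fun n => sbmProb_le_one hπ0 hπ (h0 n) (h1 n) _)
  filter_upwards [eventually_gt_atTop 0,
    tendsto_natCast_atTop_atTop.eventually_ge_atTop δ] with n hn hδn
  have hn0 : (0 : ℝ) < n := by exact_mod_cast hn
  exact le_sbmProb hπ0 hπ fun z => one_sub_failureBound_le_condProb hSsym (h0 n) (h1 n) (hρ n) hs1
    (fun a b => (le_sMax S a b).trans (le_max_left _ _)) hδ hn ((div_le_iff₀ hn0).1 (hlog n)) hδn z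
end SBM
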